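/- The generating function of the shifted polynomials c_{n+1} evaluated at t = 1 is ∑_{n≥0} c_{n+1}(1) z^n = ∑_{n≥0} C(n+1, ⌊(n+1)/2⌋) z^n; that is, c_{n+1}(1) = C(n+1, ⌊(n+1)/2⌋) for all n ≥ 0, where C(a,b) denotes the binomial coefficient. -/

import Mathlib

open Polynomial Finset

/-- `v n k = C(⌊(n-1)/2⌋, ⌊k/2⌋) * C(⌊n/2⌋, ⌊(k+1)/2⌋)` -/
def v (n k : ℕ) : ℕ := Nat.choose ((n - 1) / 2) (k / 2) * Nat.choose (n / 2) ((k + 1) / 2)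

/-- The polynomials `c n`, i.e. the q-Narayana polynomials at q = -1. -/
noncomputable def c : ℕ → Polynomial ℤ
  | 0 => 1
  | n + 1 => ∑ k ∈ Finset.range (n + 1), Polynomial.C (v (n + 1) k : ℤ) * Polynomial.X ^ k

theorem sum_range_two_mul {M : Type*} [AddCommMonoid M] (f : ℕ → M) (m : ℕ) :
    ∑ k ∈ Finset.range (2 * m), f k = ∑ j ∈ Finset.range m, (f (2 * j) + f (2 * j + 1)) := by
  induction m with
  | zero => simp
  | succ m ih =>
    rw [Nat.mul_succ, Finset.sum_range_succ, Finset.sum_range_succ, ih, Finset.sum_range_succ,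
      add_assoc]

/-- A form of Vandermonde's identity. -/
theorem sum_choose_mul_choose_succ (a b : ℕ) :
    ∑ j ∈ Finset.range (a + 1), a.choose j * b.choose (j + 1) = (b + a).choose (a + 1) := by
  rw [Nat.add_choose_eq, Finset.Nat.antidiagonal_succ, Finset.sum_cons, Finset.sum_map,
    Finset.Nat.sum_antidiagonal_eq_sum_range_succ_mk]
  simp only [Nat.choose_succ_self, mul_zero, zero_add]
  refine Finset.sum_congr rfl fun j hj => ?_
  have hj' : j ≤ a := Nat.lt_succ_iff.mp (Finset.mem_range.mp hj)
  simp [Nat.choose_symm hj', mul_comm]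

theorem v_two_mul_add_v_two_mul_add_one (n j : ℕ) :
    v n (2 * j) + v n (2 * j + 1) =
      ((n - 1) / 2).choose j * (n / 2 + 1).choose (j + 1) := by
  have h₀ : 2 * j / 2 = j := by omega
  have h₁ : (2 * j + 1) / 2 = j := by omega
  have h₂ : (2 * j + 1 + 1) / 2 = j + 1 := by omega
  rw [v, v, h₀, h₁, h₂, Nat.choose_succ_succ', mul_add]

theorem sum_range_v (n : ℕ) :
    ∑ k ∈ Finset.range (n + 1), v (n + 1) k = (n + 1).choose ((n + 1) / 2) := by
  have hext : ∑ k ∈ Finset.range (n + 1), v (n + 1) k =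
      ∑ k ∈ Finset.range (2 * (n / 2 + 1)), v (n + 1) k := by
    refine Finset.sum_subset (Finset.range_mono (by omega)) fun k hk hk' => ?_
    rw [Finset.mem_range] at hk hk'
    rw [v, Nat.choose_eq_zero_of_lt (show (n + 1) / 2 < (k + 1) / 2 by omega), mul_zero]
  rw [hext, sum_range_two_mul]
  simp only [v_two_mul_add_v_two_mul_add_one, Nat.add_sub_cancel]
  rw [sum_choose_mul_choose_succ, show (n + 1) / 2 + 1 + n / 2 = n + 1 by omega]
  exact Nat.choose_symm_of_eq_add (by omega)

theorem eval_one_c_succ (n : ℕ) :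
    (c (n + 1)).eval 1 = (Nat.choose (n + 1) ((n + 1) / 2) : ℤ) := by
  rw [← sum_range_v, c, Polynomial.eval_finsetSum]
  simp

/-- `∑_{n≥0} c_{n+1}(1) zⁿ = ∑_{n≥0} C(n+1, ⌊(n+1)/2⌋) zⁿ` over `ℤ`; that is,
`c_{n+1}(1) = C(n+1, ⌊(n+1)/2⌋)` for all `n ≥ 0`. -/
theorem statement19 :
    (PowerSeries.mk (fun n => (c (n + 1)).eval 1) : PowerSeries ℤ) =
        PowerSeries.mk (fun n => (Nat.choose (n + 1) ((n + 1) / 2) : ℤ)) ∧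
      ∀ n : ℕ, (c (n + 1)).eval 1 = (Nat.choose (n + 1) ((n + 1) / 2) : ℤ) := by
  exact ⟨by simp only [eval_one_c_succ], eval_one_c_succ⟩
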